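/- arXiv:2102.09593 — 3 statements merged into one kernel-verified Lean document; each statement's English description precedes it below -/
import Mathlib

section
/- Let (X, Δ, ε) be a cocommutative coalgebra over a commutative ring k and let T : X⊗X⊗X → X be an invertible ternary self-distributive coalgebra morphism. Then for all x, z, w ∈ X, T( x ⊗ T(z⁽¹⁾⊗z⁽²⁾⊗w⁽²⁾) ⊗ T(w⁽¹⁾⊗z⁽³⁾⊗w⁽³⁾) ) = T(x ⊗ z ⊗ w), as an identity of k-linear maps X^{⊗3} → X. -/
open TensorProduct

/-- The finite family `(x1 i) ⊗ (x2 i)` represents the comultiplication of `x`. -/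
def Rep2 (k : Type*) {X : Type*} [CommRing k] [AddCommMonoid X] [Module k X] [Coalgebra k X]
    (x : X) {n : ℕ} (x1 x2 : Fin n → X) : Prop :=
  Coalgebra.comul (R := k) x = ∑ i, x1 i ⊗ₜ[k] x2 i

/-- The twofold iterated comultiplication `x ↦ x⁽¹⁾ ⊗ (x⁽²⁾ ⊗ x⁽³⁾)`. -/
noncomputable def delta3 (k : Type*) {X : Type*} [CommRing k] [AddCommMonoid X] [Module k X]
    [Coalgebra k X] : X →ₗ[k] X ⊗[k] (X ⊗[k] X) :=
  (LinearMap.lTensor X (Coalgebra.comul (R := k))) ∘ₗ Coalgebra.comul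

/-- The finite family `(x1 i) ⊗ (x2 i) ⊗ (x3 i)` represents the iterated comultiplication
`x⁽¹⁾ ⊗ x⁽²⁾ ⊗ x⁽³⁾` of `x`. -/
def Rep3 (k : Type*) {X : Type*} [CommRing k] [AddCommMonoid X] [Module k X] [Coalgebra k X]
    (x : X) {n : ℕ} (x1 x2 x3 : Fin n → X) : Prop :=
  delta3 k x = ∑ i, x1 i ⊗ₜ[k] (x2 i ⊗ₜ[k] x3 i)

/-- `T` is ternary self-distributive. -/
def IsTSD (k : Type*) {X : Type*} [CommRing k] [AddCommMonoid X] [Module k X] [Coalgebra k X]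
    (T : X ⊗[k] (X ⊗[k] X) →ₗ[k] X) : Prop :=
  ∀ (x y z u v : X) {n m : ℕ} (u1 u2 u3 : Fin n → X) (v1 v2 v3 : Fin m → X),
    Rep3 k u u1 u2 u3 → Rep3 k v v1 v2 v3 →
    T (T (x ⊗ₜ[k] (y ⊗ₜ[k] z)) ⊗ₜ[k] (u ⊗ₜ[k] v)) =
      ∑ i, ∑ j, T (T (x ⊗ₜ[k] (u1 i ⊗ₜ[k] v1 j)) ⊗ₜ[k]
        (T (y ⊗ₜ[k] (u2 i ⊗ₜ[k] v2 j)) ⊗ₜ[k] T (z ⊗ₜ[k] (u3 i ⊗ₜ[k] v3 j))))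

/-- `T` is invertible. -/
def IsInvertibleTSD (k : Type*) {X : Type*} [CommRing k] [AddCommMonoid X] [Module k X]
    [Coalgebra k X] (T : X ⊗[k] (X ⊗[k] X) →ₗ[k] X) : Prop :=
  ∀ (x y z : X) {n m : ℕ} (y1 y2 : Fin n → X) (z1 z2 : Fin m → X),
    Rep2 k y y1 y2 → Rep2 k z z1 z2 →
    ∑ i, ∑ j, T (T (x ⊗ₜ[k] (y2 i ⊗ₜ[k] z2 j)) ⊗ₜ[k] (z1 j ⊗ₜ[k] y1 i)) =
      (Coalgebra.counit (R := k) y * Coalgebra.counit (R := k) z) • x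

/-- `T` is a coalgebra morphism. -/
def IsCoalgMor (k : Type*) {X : Type*} [CommRing k] [AddCommMonoid X] [Module k X]
    [Coalgebra k X] (T : X ⊗[k] (X ⊗[k] X) →ₗ[k] X) : Prop :=
  (∀ x y z : X, Coalgebra.counit (R := k) (T (x ⊗ₜ[k] (y ⊗ₜ[k] z))) =
      Coalgebra.counit (R := k) x * Coalgebra.counit (R := k) y * Coalgebra.counit (R := k) z) ∧
  (∀ (x y z : X) {n₁ n₂ n₃ : ℕ} (x1 x2 : Fin n₁ → X) (y1 y2 : Fin n₂ → X) (z1 z2 : Fin n₃ → X),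
    Rep2 k x x1 x2 → Rep2 k y y1 y2 → Rep2 k z z1 z2 →
    Coalgebra.comul (R := k) (T (x ⊗ₜ[k] (y ⊗ₜ[k] z))) =
      ∑ i, ∑ j, ∑ l, T (x1 i ⊗ₜ[k] (y1 j ⊗ₜ[k] z1 l)) ⊗ₜ[k] T (x2 i ⊗ₜ[k] (y2 j ⊗ₜ[k] z2 l)))

open Coalgebra WithConv

section Abstract

variable {k C A : Type*} [CommRing k] [AddCommGroup C] [Module k C] [Coalgebra k C]
  [Ring A] [Algebra k A]

/-- Convolution form of the slide identity: if `R c * R d = ∑ R (P c⁽¹⁾ d) * R c⁽²⁾` and `R` has a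
right convolution inverse, then `∑ R (P c⁽²⁾ c⁽¹⁾) = R c`. -/
theorem comp_lift_flip_comp_comul_eq [IsCocomm k C] (R R' : C →ₗ[k] A) (P : C →ₗ[k] C →ₗ[k] C)
    (hP : ∀ c d, R c * R d = LinearMap.mul' k A (map (R ∘ₗ P.flip d) R (comul c)))
    (hR : toConv R * toConv R' = 1) :
    R ∘ₗ lift P.flip ∘ₗ comul = R := by
  have key : toConv (R ∘ₗ lift P.flip ∘ₗ comul) * toConv R = toConv R * toConv R := by
    ext c
    simp only [LinearMap.convMul_def, LinearMap.comp_apply]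
    have h₁ : map (R ∘ₗ lift P.flip ∘ₗ comul) R =
        map (R ∘ₗ lift P.flip) R ∘ₗ (comul (R := k) (A := C)).rTensor C := by
      ext; simp
    have h₂ : LinearMap.mul' k A ∘ₗ map (R ∘ₗ lift P.flip) R ∘ₗ
          (TensorProduct.assoc k C C C).symm.toLinearMap ∘ₗ (comul (R := k) (A := C)).lTensor C =
        LinearMap.mul' k A ∘ₗ map R R ∘ₗ (TensorProduct.comm k C C).toLinearMap := by
      ext a b
      have h₃ : ∀ t : C ⊗[k] C, map (R ∘ₗ lift P.flip) R ((TensorProduct.assoc k C C C).symm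
          (a ⊗ₜ t)) = map (R ∘ₗ P.flip a) R t := by
        intro t
        induction t with
        | zero => simp
        | tmul x y => simp
        | add x y hx hy => rw [tmul_add, map_add, map_add, map_add, hx, hy]
      simp [h₃, hP]
    rw [h₁, LinearMap.comp_apply, ← coassoc_symm_apply]
    have := LinearMap.congr_fun h₂ (comul c)
    simpa using this
  have h := congrArg (· * toConv R') key
  simp only [mul_assoc, hR, mul_one] at h
  exact toConv_injective h

end Abstract

section Representations

variable {k X : Type*} [CommRing k] [AddCommGroup X] [Module k X]

theorem exists_fin_sum_tmul {M N : Type*} [AddCommMonoid M] [Module k M] [AddCommMonoid N]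
    [Module k N] (t : M ⊗[k] N) :
    ∃ (n : ℕ) (f : Fin n → M) (g : Fin n → N), t = ∑ i, f i ⊗ₜ[k] g i := by
  induction t with
  | zero => exact ⟨0, Fin.elim0, Fin.elim0, by simp⟩
  | tmul x y => exact ⟨1, fun _ => x, fun _ => y, by simp⟩
  | add s t hs ht =>
    obtain ⟨n, f, g, rfl⟩ := hs
    obtain ⟨m, f', g', rfl⟩ := ht
    exact ⟨n + m, Fin.append f f', Fin.append g g', by simp [Fin.sum_univ_add]⟩

theorem exists_fin_sum_tmul_tmul {M N P : Type*} [AddCommMonoid M] [Module k M] [AddCommMonoid N]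
    [Module k N] [AddCommMonoid P] [Module k P] (t : M ⊗[k] (N ⊗[k] P)) :
    ∃ (n : ℕ) (f : Fin n → M) (g : Fin n → N) (h : Fin n → P),
      t = ∑ i, f i ⊗ₜ[k] (g i ⊗ₜ[k] h i) := by
  induction t with
  | zero => exact ⟨0, Fin.elim0, Fin.elim0, Fin.elim0, by simp⟩
  | tmul x y =>
    obtain ⟨n, g, h, rfl⟩ := exists_fin_sum_tmul y
    exact ⟨n, fun _ => x, g, h, tmul_sum ..⟩
  | add s t hs ht =>
    obtain ⟨n, f, g, h, rfl⟩ := hs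
    obtain ⟨m, f', g', h', rfl⟩ := ht
    exact ⟨n + m, Fin.append f f', Fin.append g g', Fin.append h h', by
      simp [Fin.sum_univ_add]⟩

variable [Coalgebra k X]

theorem comul_tmul_eq_sum {z w : X} {n m : ℕ} {z1 z2 : Fin n → X} {w1 w2 : Fin m → X}
    (hz : Rep2 k z z1 z2) (hw : Rep2 k w w1 w2) :
    comul (R := k) (z ⊗ₜ[k] w) =
      ∑ i, ∑ j, (z1 i ⊗ₜ[k] w1 j) ⊗ₜ[k] (z2 i ⊗ₜ[k] w2 j) := by
  rw [TensorProduct.comul_tmul, hz, hw, Finset.sum_comm]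
  simp [sum_tmul, tmul_sum]

theorem lTensor_comul_comul_tmul (z w : X) :
    (comul (R := k) (A := X ⊗[k] X)).lTensor _ (comul (z ⊗ₜ[k] w)) =
      (tensorTensorTensorComm k X X X X).toLinearMap.lTensor _
        (tensorTensorTensorComm k X (X ⊗[k] X) X (X ⊗[k] X) (delta3 k z ⊗ₜ delta3 k w)) := by
  obtain ⟨n, z1, z2, hz⟩ := exists_fin_sum_tmul (comul (R := k) z)
  obtain ⟨m, w1, w2, hw⟩ := exists_fin_sum_tmul (comul (R := k) w)
  rw [comul_tmul_eq_sum hz hw, delta3, LinearMap.comp_apply, LinearMap.comp_apply, hz, hw]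
  rw [Finset.sum_comm]
  simp [sum_tmul, tmul_sum, TensorProduct.comul_tmul, AlgebraTensorModule.tensorTensorTensorComm_eq]

theorem lTensor_comul_comul_tmul_eq_sum {z w : X} {n m : ℕ} {z1 z2 z3 : Fin n → X}
    {w1 w2 w3 : Fin m → X} (hz : Rep3 k z z1 z2 z3) (hw : Rep3 k w w1 w2 w3) :
    (comul (R := k) (A := X ⊗[k] X)).lTensor _ (comul (z ⊗ₜ[k] w)) =
      ∑ i, ∑ j, (z1 i ⊗ₜ[k] w1 j) ⊗ₜ[k]
        ((z2 i ⊗ₜ[k] w2 j) ⊗ₜ[k] (z3 i ⊗ₜ[k] w3 j)) := by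
  rw [lTensor_comul_comul_tmul, hz, hw, Finset.sum_comm]
  simp [sum_tmul, tmul_sum]

end Representations

section Translations

variable {k X : Type*} [CommRing k] [AddCommGroup X] [Module k X]

/-- Right translation `y ⊗ z ↦ (x ↦ T (x ⊗ y ⊗ z))`. -/
noncomputable def rightTranslation (T : X ⊗[k] (X ⊗[k] X) →ₗ[k] X) :
    X ⊗[k] X →ₗ[k] Module.End k X :=
  (curry T).flip

@[simp]
theorem rightTranslation_apply (T : X ⊗[k] (X ⊗[k] X) →ₗ[k] X) (c : X ⊗[k] X) (x : X) :
    rightTranslation T c x = T (x ⊗ₜ c) := rfl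

/-- The componentwise right translation
`c ⊗ d ↦ (y ⊗ z ↦ T (y ⊗ c) ⊗ T (z ⊗ d))`. -/
noncomputable def pairTranslation (T : X ⊗[k] (X ⊗[k] X) →ₗ[k] X) :
    (X ⊗[k] X) ⊗[k] (X ⊗[k] X) →ₗ[k] X ⊗[k] X →ₗ[k] X ⊗[k] X :=
  homTensorHomMap (.id k) X X X X ∘ₗ map (rightTranslation T) (rightTranslation T)

@[simp]
theorem pairTranslation_tmul (T : X ⊗[k] (X ⊗[k] X) →ₗ[k] X) (c d : X ⊗[k] X) (y z : X) :
    pairTranslation T (c ⊗ₜ d) (y ⊗ₜ z) = T (y ⊗ₜ c) ⊗ₜ T (z ⊗ₜ d) := rfl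

variable [Coalgebra k X]

theorem IsInvertibleTSD.convMul_eq_one {T : X ⊗[k] (X ⊗[k] X) →ₗ[k] X}
    (hT : IsInvertibleTSD k T) :
    toConv (rightTranslation T) *
      toConv (rightTranslation T ∘ₗ (TensorProduct.comm k X X).toLinearMap) = 1 := by
  ext z y x
  obtain ⟨n, z1, z2, hz⟩ := exists_fin_sum_tmul (comul (R := k) z)
  obtain ⟨m, y1, y2, hy⟩ := exists_fin_sum_tmul (comul (R := k) y)
  have h := hT x y z y1 y2 z1 z2 hy hz
  rw [Finset.sum_comm] at h
  simp only [AlgebraTensorModule.curry_apply, LinearMap.restrictScalars_self, curry_apply,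
    LinearMap.convMul_def, LinearMap.comp_apply, comul_tmul_eq_sum hz hy]
  simpa [LinearMap.sum_apply, LinearMap.convOne_def, Algebra.algebraMap_eq_smul_one] using h

theorem IsTSD.rightTranslation_mul {T : X ⊗[k] (X ⊗[k] X) →ₗ[k] X} (hT : IsTSD k T)
    [IsCocomm k X] (c d : X ⊗[k] X) :
    rightTranslation T c * rightTranslation T d =
      LinearMap.mul' k (Module.End k X)
        (map (rightTranslation T ∘ₗ (pairTranslation T ∘ₗ comul).flip d)
          (rightTranslation T) (comul c)) := by
  have h₁ : map (rightTranslation T ∘ₗ (pairTranslation T ∘ₗ comul).flip d)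
        (rightTranslation T) (comul c) =
      TensorProduct.comm k _ _ (map (rightTranslation T)
        (rightTranslation T ∘ₗ (pairTranslation T).flip d)
        ((comul (R := k) (A := X ⊗[k] X)).lTensor _ (comul c))) := by
    conv_lhs => rw [← comm_comul k c]
    generalize comul (R := k) c = t
    induction t with
    | zero => simp
    | tmul a b => simp
    | add s t hs ht => simp only [map_add, hs, ht]
  rw [h₁]
  clear h₁
  induction c with
  | zero => simp
  | add s t hs ht => simp only [map_add, add_mul, hs, ht]
  | tmul u v =>
    induction d with
    | zero => simp
    | add s t hs ht => simp only [map_add, mul_add, hs, ht, LinearMap.comp_add, map_add_right,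
        LinearMap.add_apply]
    | tmul y z =>
      obtain ⟨n, u1, u2, u3, hu⟩ := exists_fin_sum_tmul_tmul (delta3 k u)
      obtain ⟨m, v1, v2, v3, hv⟩ := exists_fin_sum_tmul_tmul (delta3 k v)
      ext x
      have h := hT x y z u v u1 u2 u3 v1 v2 v3 hu hv
      rw [lTensor_comul_comul_tmul_eq_sum hu hv]
      simpa [LinearMap.sum_apply] using h

end Translations

/-- for an invertible TSD coalgebra morphism `T` on a cocommutative coalgebra,
`T(x ⊗ T(z⁽¹⁾⊗z⁽²⁾⊗w⁽²⁾) ⊗ T(w⁽¹⁾⊗z⁽³⁾⊗w⁽³⁾)) = T(x⊗z⊗w)`. -/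
theorem slide_loop (k X : Type*) [CommRing k] [AddCommGroup X] [Module k X] [Coalgebra k X]
    (hcc : ∀ a : X, TensorProduct.comm k X X (Coalgebra.comul a) = Coalgebra.comul a)
    (T : X ⊗[k] (X ⊗[k] X) →ₗ[k] X)
    (hTSD : IsTSD k T) (hTinv : IsInvertibleTSD k T) (hTmor : IsCoalgMor k T)
    (x z w : X) {n m : ℕ} (z1 z2 z3 : Fin n → X) (w1 w2 w3 : Fin m → X)
    (hz : Rep3 k z z1 z2 z3) (hw : Rep3 k w w1 w2 w3) :
    ∑ i, ∑ j, T (x ⊗ₜ[k]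
        (T (z1 i ⊗ₜ[k] (z2 i ⊗ₜ[k] w2 j)) ⊗ₜ[k] T (w1 j ⊗ₜ[k] (z3 i ⊗ₜ[k] w3 j)))) =
      T (x ⊗ₜ[k] (z ⊗ₜ[k] w)) := by
  have : IsCocomm k X := ⟨LinearMap.ext hcc⟩
  have h := comp_lift_flip_comp_comul_eq (rightTranslation T) _ (pairTranslation T ∘ₗ comul)
    hTSD.rightTranslation_mul hTinv.convMul_eq_one
  have h₁ : lift (pairTranslation T ∘ₗ comul).flip =
      lift (pairTranslation T).flip ∘ₗ (comul (R := k) (A := X ⊗[k] X)).lTensor _ := by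
    ext; simp
  rw [h₁] at h
  have h₂ := LinearMap.congr_fun (LinearMap.congr_fun h (z ⊗ₜ w)) x
  simp only [LinearMap.comp_apply, lTensor_comul_comul_tmul_eq_sum hz hw] at h₂
  simpa [tmul_sum] using h₂
end

section
/- Let (X, Δ, ε) be a cocommutative coalgebra over a commutative ring k and let T : X⊗X⊗X → X be an invertible ternary self-distributive coalgebra morphism. Define the twist θ : X⊗X → X⊗X by θ(x⊗y) = T(x⁽¹⁾⊗x⁽²⁾⊗y⁽²⁾) ⊗ T(y⁽¹⁾⊗x⁽³⁾⊗y⁽³⁾) and the braiding β : X^{⊗4} → X^{⊗4} by β(x⊗x'⊗y⊗z) = y⁽¹⁾ ⊗ z⁽¹⁾ ⊗ T(x⊗y⁽²⁾⊗z⁽²⁾) ⊗ T(x'⊗y⁽³⁾⊗z⁽³⁾). Then the twist commutes with the braiding: β ∘ (θ ⊗ id_{X⊗X}) = (id_{X⊗X} ⊗ θ) ∘ β and β ∘ (id_{X⊗X} ⊗ θ) = (θ ⊗ id_{X⊗X}) ∘ β, as k-linear maps X^{⊗4} → X^{⊗4}. -/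
open TensorProduct

section FiniteRepresentations

variable {k M N P : Type*} [CommRing k] [AddCommMonoid M] [Module k M] [AddCommMonoid N]
  [Module k N] [AddCommMonoid P] [Module k P]

theorem exists_sum_fin_tmul (t : M ⊗[k] N) :
    ∃ (n : ℕ) (a : Fin n → M) (b : Fin n → N), t = ∑ i, a i ⊗ₜ[k] b i := by
  induction t with
  | zero => exact ⟨0, Fin.elim0, Fin.elim0, by simp⟩
  | tmul a b => exact ⟨1, fun _ => a, fun _ => b, by simp⟩
  | add s t hs ht =>
    obtain ⟨n, a, b, rfl⟩ := hs
    obtain ⟨m, c, d, rfl⟩ := ht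
    exact ⟨n + m, Fin.append a c, Fin.append b d, by simp [Fin.sum_univ_add]⟩

theorem exists_sum_fin_tmul_tmul (t : M ⊗[k] (N ⊗[k] P)) :
    ∃ (n : ℕ) (a : Fin n → M) (b : Fin n → N) (c : Fin n → P),
      t = ∑ i, a i ⊗ₜ[k] (b i ⊗ₜ[k] c i) := by
  induction t with
  | zero => exact ⟨0, Fin.elim0, Fin.elim0, Fin.elim0, by simp⟩
  | tmul a s =>
    obtain ⟨n, b, c, rfl⟩ := exists_sum_fin_tmul s
    exact ⟨n, fun _ => a, b, c, by simp [tmul_sum]⟩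
  | add s t hs ht =>
    obtain ⟨n, a, b, c, rfl⟩ := hs
    obtain ⟨m, d, e, f, rfl⟩ := ht
    exact ⟨n + m, Fin.append a d, Fin.append b e, Fin.append c f, by simp [Fin.sum_univ_add]⟩

variable {X : Type*} [AddCommMonoid X] [Module k X] [Coalgebra k X]

theorem comul_tmul_of_rep2 {y z : X} {n m : ℕ} {y1 y2 : Fin n → X} {z1 z2 : Fin m → X}
    (hy : Rep2 k y y1 y2) (hz : Rep2 k z z1 z2) :
    Coalgebra.comul (R := k) (y ⊗ₜ[k] z) =
      ∑ i, ∑ j, (y1 i ⊗ₜ[k] z1 j) ⊗ₜ[k] (y2 i ⊗ₜ[k] z2 j) := by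
  rw [TensorProduct.comul_tmul, hy, hz]
  simp [sum_tmul, tmul_sum, Finset.sum_comm (γ := Fin m)]

theorem delta3_tmul (y z : X) :
    delta3 k (y ⊗ₜ[k] z) =
      LinearMap.lTensor _ (tensorTensorTensorComm k X X X X).toLinearMap
        (tensorTensorTensorComm k X (X ⊗[k] X) X (X ⊗[k] X) (delta3 k y ⊗ₜ[k] delta3 k z)) := by
  simp only [delta3, LinearMap.comp_apply, TensorProduct.comul_tmul]
  generalize Coalgebra.comul (R := k) y = p
  generalize Coalgebra.comul (R := k) z = q
  induction p with
  | zero => simp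
  | add p p' hp hp' => simp only [add_tmul, map_add, hp, hp']
  | tmul a b =>
    induction q with
    | zero => simp
    | add q q' hq hq' => simp only [tmul_add, map_add, hq, hq']
    | tmul c d => simp [TensorProduct.AlgebraTensorModule.tensorTensorTensorComm_eq]

theorem delta3_tmul_of_rep3 {y z : X} {n m : ℕ} {y1 y2 y3 : Fin n → X} {z1 z2 z3 : Fin m → X}
    (hy : Rep3 k y y1 y2 y3) (hz : Rep3 k z z1 z2 z3) :
    delta3 k (y ⊗ₜ[k] z) =
      ∑ i, ∑ j, (y1 i ⊗ₜ[k] z1 j) ⊗ₜ[k] ((y2 i ⊗ₜ[k] z2 j) ⊗ₜ[k] (y3 i ⊗ₜ[k] z3 j)) := by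
  rw [delta3_tmul, hy, hz]
  simp [sum_tmul, tmul_sum, Finset.sum_comm (γ := Fin m)]

end FiniteRepresentations

namespace CoalgHom

section Pair

variable {k C D A B E F : Type*} [CommRing k]
  [AddCommGroup C] [Module k C] [Coalgebra k C] [Coalgebra.IsCocomm k C]
  [AddCommGroup D] [Module k D] [Coalgebra k D] [Coalgebra.IsCocomm k D]
  [AddCommGroup A] [Module k A] [Coalgebra k A] [AddCommGroup B] [Module k B] [Coalgebra k B]
  [AddCommGroup E] [Module k E] [Coalgebra k E] [AddCommGroup F] [Module k F] [Coalgebra k F]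

/-- The pairing `c ↦ f c⁽¹⁾ ⊗ g c⁽²⁾` of two morphisms out of a cocommutative coalgebra. -/
noncomputable def pair (f : C →ₗc[k] A) (g : C →ₗc[k] B) : C →ₗc[k] A ⊗[k] B :=
  (Coalgebra.TensorProduct.map f g).comp (Coalgebra.comulCoalgHom k C)

theorem pair_apply (f : C →ₗc[k] A) (g : C →ₗc[k] B) (c : C) :
    pair f g c = TensorProduct.map (f : C →ₗ[k] A) (g : C →ₗ[k] B) (Coalgebra.comul c) := rfl

theorem map_pair {A' B' : Type*} [AddCommGroup A'] [Module k A'] [AddCommGroup B'] [Module k B']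
    (f : C →ₗc[k] A) (g : C →ₗc[k] B) (φ : A →ₗ[k] A') (ψ : B →ₗ[k] B') (c : C) :
    TensorProduct.map φ ψ (pair f g c) =
      TensorProduct.map (φ ∘ₗ (f : C →ₗ[k] A)) (ψ ∘ₗ (g : C →ₗ[k] B)) (Coalgebra.comul c) := by
  rw [pair_apply, ← LinearMap.comp_apply, ← TensorProduct.map_comp]

theorem map_pair_eq_pair (f : C →ₗc[k] A) (g : C →ₗc[k] B) (φ : A →ₗ[k] E) (ψ : B →ₗ[k] F)
    (f' : C →ₗc[k] E) (g' : C →ₗc[k] F) (hf : ∀ c, φ (f c) = f' c) (hg : ∀ c, ψ (g c) = g' c)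
    (c : C) : TensorProduct.map φ ψ (pair f g c) = pair f' g' c := by
  have hf' : φ ∘ₗ (f : C →ₗ[k] A) = (f' : C →ₗ[k] E) := LinearMap.ext hf
  have hg' : ψ ∘ₗ (g : C →ₗ[k] B) = (g' : C →ₗ[k] F) := LinearMap.ext hg
  rw [map_pair, hf', hg', pair_apply]

theorem pair_comp (f : C →ₗc[k] A) (g : C →ₗc[k] B) (h : D →ₗc[k] C) :
    (pair f g).comp h = pair (f.comp h) (g.comp h) := by
  ext d
  rw [CoalgHom.coe_comp, Function.comp_apply, pair_apply,
    ← CoalgHomClass.map_comp_comul_apply h d, pair_apply, ← LinearMap.comp_apply,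
    ← TensorProduct.map_comp]
  rfl

theorem comul_apply_eq_pair (f : C →ₗc[k] A) (c : C) :
    Coalgebra.comul (R := k) (f c) = pair f f c :=
  (CoalgHomClass.map_comp_comul_apply f c).symm

theorem delta3_apply_eq_pair (f : C →ₗc[k] A) (c : C) :
    delta3 k (f c) = pair f (pair f f) c := by
  rw [delta3, LinearMap.comp_apply, comul_apply_eq_pair]
  exact map_pair_eq_pair _ _ _ _ _ _ (fun _ => rfl) (comul_apply_eq_pair f) c

theorem comm_pair (f : C →ₗc[k] A) (g : C →ₗc[k] B) (c : C) :
    TensorProduct.comm k A B (pair f g c) = pair g f c := by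
  rw [pair_apply, pair_apply]
  nth_rw 2 [← Coalgebra.comm_comul k c]
  rw [TensorProduct.map_comm]

theorem assoc_pair (f : C →ₗc[k] A) (g : C →ₗc[k] B) (h : C →ₗc[k] E) (c : C) :
    TensorProduct.assoc k A B E (pair (pair f g) h c) = pair f (pair g h) c := by
  have key : ∀ t : C ⊗[k] C,
      TensorProduct.assoc k A B E (TensorProduct.map (pair f g : C →ₗ[k] A ⊗[k] B) (h : C →ₗ[k] E) t)
        = TensorProduct.map (f : C →ₗ[k] A) (TensorProduct.map (g : C →ₗ[k] B) (h : C →ₗ[k] E))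
          (TensorProduct.assoc k C C C (LinearMap.rTensor C Coalgebra.comul t)) := by
    intro t
    induction t with
    | zero => simp
    | add s t hs ht => simp only [map_add, hs, ht]
    | tmul a b =>
      simp only [TensorProduct.map_tmul, LinearMap.rTensor_tmul, CoalgHom.coe_toLinearMap,
        pair_apply]
      generalize Coalgebra.comul (R := k) a = s
      induction s with
      | zero => simp
      | add s t hs ht => simp only [map_add, add_tmul, hs, ht]
      | tmul => simp
  rw [pair_apply, key, Coalgebra.coassoc_apply, pair_apply, ← LinearMap.comp_apply,
    LinearMap.lTensor, ← TensorProduct.map_comp]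
  rfl

theorem leftComm_pair (f : C →ₗc[k] A) (g : C →ₗc[k] B) (h : C →ₗc[k] E) (c : C) :
    TensorProduct.leftComm k A B E (pair f (pair g h) c) = pair g (pair f h) c := by
  have key : ∀ t : (A ⊗[k] B) ⊗[k] E,
      TensorProduct.leftComm k A B E (TensorProduct.assoc k A B E t) =
        TensorProduct.assoc k B A E
          (TensorProduct.map (TensorProduct.comm k A B).toLinearMap LinearMap.id t) := by
    intro t
    refine LinearMap.congr_fun (f := (TensorProduct.leftComm k A B E).toLinearMap ∘ₗ
      (TensorProduct.assoc k A B E).toLinearMap) (g := (TensorProduct.assoc k B A E).toLinearMap ∘ₗ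
          (TensorProduct.map (TensorProduct.comm k A B).toLinearMap LinearMap.id)) ?_ t
    ext
    simp
  rw [← assoc_pair, key,
    map_pair_eq_pair _ _ _ _ (pair g f) h (comm_pair f g) (fun _ => rfl), assoc_pair]

theorem tensorTensorTensorComm_pair (a : C →ₗc[k] A) (b : C →ₗc[k] B) (e : C →ₗc[k] E)
    (f : C →ₗc[k] F) (c : C) :
    tensorTensorTensorComm k A B E F (pair (pair a b) (pair e f) c) =
      pair (pair a e) (pair b f) c := by
  have h := comul_apply_eq_pair (Coalgebra.comulCoalgHom k C) c
  rw [pair_apply] at h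
  replace h : tensorTensorTensorComm k C C C C
      (TensorProduct.map Coalgebra.comul Coalgebra.comul (Coalgebra.comul (R := k) c)) =
      TensorProduct.map Coalgebra.comul Coalgebra.comul (Coalgebra.comul (R := k) c) := h
  have h' := congrArg (TensorProduct.map
    (TensorProduct.map (a : C →ₗ[k] A) (e : C →ₗ[k] E))
    (TensorProduct.map (b : C →ₗ[k] B) (f : C →ₗ[k] F))) h
  rw [← LinearMap.comp_apply (TensorProduct.map _ _) (TensorProduct.map _ _),
    ← TensorProduct.map_comp] at h'
  refine Eq.trans ?_ h'
  rw [pair_apply]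
  have key : ∀ t : (C ⊗[k] C) ⊗[k] (C ⊗[k] C),
      tensorTensorTensorComm k A B E F
        (TensorProduct.map (TensorProduct.map (a : C →ₗ[k] A) (b : C →ₗ[k] B))
          (TensorProduct.map (e : C →ₗ[k] E) (f : C →ₗ[k] F)) t) =
      TensorProduct.map (TensorProduct.map (a : C →ₗ[k] A) (e : C →ₗ[k] E))
          (TensorProduct.map (b : C →ₗ[k] B) (f : C →ₗ[k] F))
        (tensorTensorTensorComm k C C C C t) := by
    intro t
    refine LinearMap.congr_fun (f := (tensorTensorTensorComm k A B E F).toLinearMap ∘ₗ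
      TensorProduct.map (TensorProduct.map (a : C →ₗ[k] A) (b : C →ₗ[k] B))
        (TensorProduct.map (e : C →ₗ[k] E) (f : C →ₗ[k] F)))
      (g := TensorProduct.map (TensorProduct.map (a : C →ₗ[k] A) (e : C →ₗ[k] E))
          (TensorProduct.map (b : C →ₗ[k] B) (f : C →ₗ[k] F)) ∘ₗ
        (tensorTensorTensorComm k C C C C).toLinearMap) ?_ t
    ext
    simp
  rw [← key, ← LinearMap.comp_apply (TensorProduct.map _ _) (TensorProduct.map _ _),
    ← TensorProduct.map_comp]
  rfl

variable (k A B) in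
/-- The first projection `a ⊗ b ↦ ε(b) a`. -/
noncomputable def fst : A ⊗[k] B →ₗc[k] A :=
  (Coalgebra.TensorProduct.rid k k A : A ⊗[k] k →ₗc[k] A).comp
    (Coalgebra.TensorProduct.map (CoalgHom.id k A) (Coalgebra.counitCoalgHom k B))

variable (k A B) in
/-- The second projection `a ⊗ b ↦ ε(a) b`. -/
noncomputable def snd : A ⊗[k] B →ₗc[k] B :=
  (Coalgebra.TensorProduct.lid k B : k ⊗[k] B →ₗc[k] B).comp
    (Coalgebra.TensorProduct.map (Coalgebra.counitCoalgHom k A) (CoalgHom.id k B))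

theorem fst_tmul (a : A) (b : B) : fst k A B (a ⊗ₜ b) = Coalgebra.counit (R := k) b • a := rfl

theorem snd_tmul (a : A) (b : B) : snd k A B (a ⊗ₜ b) = Coalgebra.counit (R := k) a • b := rfl

theorem rid_map_counit_pair (f : C →ₗc[k] A) (g : C →ₗc[k] B) (c : C) :
    TensorProduct.rid k A (LinearMap.lTensor A Coalgebra.counit (pair f g c)) = f c := by
  have hg : Coalgebra.counit ∘ₗ (g : C →ₗ[k] B) = Coalgebra.counit (R := k) := g.counit_comp
  rw [LinearMap.lTensor, map_pair, hg, LinearMap.id_comp]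
  have h := congrArg (fun t => TensorProduct.rid k A
    (LinearMap.rTensor k (f : C →ₗ[k] A) t)) (Coalgebra.lTensor_counit_comul (R := k) c)
  simp only [LinearMap.rTensor_tmul, TensorProduct.rid_tmul, one_smul] at h
  rw [← LinearMap.comp_apply (LinearMap.rTensor _ _), LinearMap.rTensor_comp_lTensor] at h
  exact h

theorem pair_fst_snd : pair (fst k C D) (snd k C D) = CoalgHom.id k (C ⊗[k] D) := by
  apply CoalgHom.coe_linearMap_injective
  ext c d
  have key : ∀ (s : C ⊗[k] C) (t : D ⊗[k] D),
      TensorProduct.map (fst k C D : C ⊗[k] D →ₗ[k] C) (snd k C D : C ⊗[k] D →ₗ[k] D)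
        (tensorTensorTensorComm k C C D D (s ⊗ₜ[k] t)) =
      TensorProduct.map (TensorProduct.rid k C).toLinearMap (TensorProduct.lid k D).toLinearMap
        (LinearMap.lTensor C Coalgebra.counit s ⊗ₜ[k]
          LinearMap.rTensor D Coalgebra.counit t) := by
    intro s t
    induction s with
    | zero => simp
    | add s s' hs hs' => simp only [add_tmul, map_add, hs, hs']
    | tmul a b =>
      induction t with
      | zero => simp
      | add t t' ht ht' => simp only [tmul_add, map_add, ht, ht']
      | tmul e f =>
        simp [fst_tmul, snd_tmul, ← smul_tmul', smul_comm (Coalgebra.counit (R := k) b)]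
  have h := key (Coalgebra.comul c) (Coalgebra.comul d)
  rw [Coalgebra.lTensor_counit_comul, Coalgebra.rTensor_counit_comul] at h
  simpa [pair_apply, TensorProduct.AlgebraTensorModule.tensorTensorTensorComm_eq] using h

end Pair

end CoalgHom

theorem exists_rep2 {k X : Type*} [CommRing k] [AddCommMonoid X] [Module k X] [Coalgebra k X]
    (x : X) : ∃ (n : ℕ) (x1 x2 : Fin n → X), Rep2 k x x1 x2 :=
  exists_sum_fin_tmul _

theorem exists_rep3 {k X : Type*} [CommRing k] [AddCommMonoid X] [Module k X] [Coalgebra k X]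
    (x : X) : ∃ (n : ℕ) (x1 x2 x3 : Fin n → X), Rep3 k x x1 x2 x3 :=
  exists_sum_fin_tmul_tmul _

/-- A trilinear operation satisfying `IsCoalgMor` as a bundled coalgebra morphism. -/
noncomputable def IsCoalgMor.toCoalgHom {k X : Type*} [CommRing k] [AddCommMonoid X] [Module k X]
    [Coalgebra k X] {T : X ⊗[k] (X ⊗[k] X) →ₗ[k] X} (hT : IsCoalgMor k T) :
    X ⊗[k] (X ⊗[k] X) →ₗc[k] X where
  toLinearMap := T
  counit_comp := by
    ext x y z
    simp [hT.1, mul_comm, mul_left_comm]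
  map_comp_comul := by
    ext x y z
    obtain ⟨_, x1, x2, hx⟩ := exists_rep2 (k := k) x
    obtain ⟨_, y1, y2, hy⟩ := exists_rep2 (k := k) y
    obtain ⟨_, z1, z2, hz⟩ := exists_rep2 (k := k) z
    have hx' : Coalgebra.comul (R := k) x = _ := hx
    simp only [AlgebraTensorModule.curry_apply, LinearMap.restrictScalars_self, curry_apply,
      LinearMap.coe_comp, Function.comp_apply, hT.2 x y z x1 x2 y1 y2 z1 z2 hx hy hz]
    rw [TensorProduct.comul_tmul, comul_tmul_of_rep2 hy hz, hx']
    simp only [sum_tmul, tmul_sum, map_sum,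
      TensorProduct.AlgebraTensorModule.tensorTensorTensorComm_eq, tensorTensorTensorComm_tmul,
      map_tmul]
    conv_lhs => enter [2, i]; rw [Finset.sum_comm]
    exact Finset.sum_comm

section Braiding

open CoalgHom

variable {k X C : Type*} [CommRing k] [AddCommGroup X] [Module k X] [Coalgebra k X]
  [AddCommGroup C] [Module k C] [Coalgebra k C] [Coalgebra.IsCocomm k C]
  {T : X ⊗[k] (X ⊗[k] X) →ₗc[k] X}

/-- The action `T(a⁽¹⁾ ⊗ w⁽²⁾)` of a generalized point of `X ⊗ X` on one of `X`. -/
noncomputable abbrev ternaryAct (T : X ⊗[k] (X ⊗[k] X) →ₗc[k] X) (a : C →ₗc[k] X)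
    (w : C →ₗc[k] X ⊗[k] X) : C →ₗc[k] X :=
  T.comp (pair a w)

theorem ternaryAct_ternaryAct (hT : IsTSD k (T : X ⊗[k] (X ⊗[k] X) →ₗ[k] X))
    (x y z u v : C →ₗc[k] X) :
    ternaryAct T (ternaryAct T x (pair y z)) (pair u v) =
      ternaryAct T (ternaryAct T x (pair u v))
        (pair (ternaryAct T y (pair u v)) (ternaryAct T z (pair u v))) := by
  let T' : X ⊗[k] (X ⊗[k] X) →ₗ[k] X := T
  let W := X ⊗[k] X
  have key : T' ∘ₗ TensorProduct.map T' (LinearMap.id (M := W)) =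
      T' ∘ₗ TensorProduct.map T' (TensorProduct.map T' T') ∘ₗ
        TensorProduct.map LinearMap.id (tensorTensorTensorComm k X X W W).toLinearMap ∘ₗ
        (tensorTensorTensorComm k X W W (W ⊗[k] W)).toLinearMap ∘ₗ
        TensorProduct.map LinearMap.id (delta3 k) := by
    ext x y z u v
    obtain ⟨_, u1, u2, u3, hu⟩ := exists_rep3 (k := k) u
    obtain ⟨_, v1, v2, v3, hv⟩ := exists_rep3 (k := k) v
    have h := hT x y z u v u1 u2 u3 v1 v2 v3 hu hv
    simp [delta3_tmul_of_rep3 hu hv, tmul_sum, T', W]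
    simpa using h
  ext c
  have h := LinearMap.congr_fun key (pair (pair x (pair y z)) (pair u v) c)
  simp only [LinearMap.comp_apply] at h
  rw [map_pair_eq_pair _ _ T' _ (ternaryAct T x (pair y z)) (pair u v) (fun _ => rfl)
      (fun _ => rfl),
    map_pair_eq_pair _ _ _ _ (pair x (pair y z)) _ (fun _ => rfl)
      (delta3_apply_eq_pair (pair u v)),
    LinearEquiv.coe_coe, tensorTensorTensorComm_pair,
    map_pair_eq_pair _ _ _ _ (pair x (pair u v)) _ (fun _ => rfl)
      (tensorTensorTensorComm_pair y z (pair u v) (pair u v)),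
    map_pair_eq_pair _ _ T' _ (ternaryAct T x (pair u v)) _ (fun _ => rfl)
      (map_pair_eq_pair _ _ T' T' (ternaryAct T y (pair u v)) (ternaryAct T z (pair u v))
        (fun _ => rfl) (fun _ => rfl))] at h
  exact h

theorem ternaryAct_ternaryAct_swap [Coalgebra.IsCocomm k X]
    (hT : IsInvertibleTSD k (T : X ⊗[k] (X ⊗[k] X) →ₗ[k] X))
    (x y z : C →ₗc[k] X) :
    ternaryAct T (ternaryAct T x (pair y z)) (pair z y) = x := by
  let T' : X ⊗[k] (X ⊗[k] X) →ₗ[k] X := T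
  let W := X ⊗[k] X
  have key : T' ∘ₗ TensorProduct.map T' (TensorProduct.comm k X X).toLinearMap ∘ₗ
        (TensorProduct.assoc k X W W).symm.toLinearMap ∘ₗ
        LinearMap.lTensor X (Coalgebra.comul (R := k) (A := W)) =
      (TensorProduct.rid k X).toLinearMap ∘ₗ LinearMap.lTensor X (Coalgebra.counit (A := W)) := by
    ext x y z
    obtain ⟨_, y1, y2, hy⟩ := exists_rep2 (k := k) y
    obtain ⟨_, z1, z2, hz⟩ := exists_rep2 (k := k) z
    have hswap : ∀ (a : X) {n : ℕ} (a1 a2 : Fin n → X), Rep2 k a a1 a2 → Rep2 k a a2 a1 := by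
      intro a n a1 a2 ha
      have h := Coalgebra.comm_comul k a
      rw [ha] at h
      rw [Rep2, ha, ← h]
      simp
    have h := hT x y z y2 y1 z2 z1 (hswap _ _ _ hy) (hswap _ _ _ hz)
    simp [comul_tmul_of_rep2 hy hz, tmul_sum, T', W, -TensorProduct.comul_tmul]
    simpa [mul_comm] using h
  ext c
  have h := LinearMap.congr_fun key (pair x (pair y z) c)
  simp only [LinearMap.comp_apply] at h
  rw [LinearMap.lTensor, map_pair_eq_pair _ _ _ _ x _ (fun _ => rfl)
      (comul_apply_eq_pair (pair y z)), LinearEquiv.coe_coe, ← assoc_pair,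
    LinearEquiv.symm_apply_apply,
    map_pair_eq_pair _ _ T' _ (ternaryAct T x (pair y z)) _ (fun _ => rfl) (comm_pair y z),
    LinearEquiv.coe_coe, rid_map_counit_pair] at h
  exact h

theorem ternaryAct_act_self [Coalgebra.IsCocomm k X]
    (hTSD : IsTSD k (T : X ⊗[k] (X ⊗[k] X) →ₗ[k] X))
    (hTinv : IsInvertibleTSD k (T : X ⊗[k] (X ⊗[k] X) →ₗ[k] X)) (x y z : C →ₗc[k] X) :
    ternaryAct T x (pair (ternaryAct T y (pair y z)) (ternaryAct T z (pair y z))) =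
      ternaryAct T x (pair y z) := by
  have h := ternaryAct_ternaryAct hTSD (ternaryAct T x (pair z y)) y z y z
  rw [ternaryAct_ternaryAct_swap hTinv] at h
  exact h.symm

theorem twist_pair {θ : X ⊗[k] X →ₗ[k] X ⊗[k] X}
    (hθ : ∀ (x y : X) {n m : ℕ} (x1 x2 x3 : Fin n → X) (y1 y2 y3 : Fin m → X),
      Rep3 k x x1 x2 x3 → Rep3 k y y1 y2 y3 →
      θ (x ⊗ₜ[k] y) = ∑ i, ∑ j,
        T (x1 i ⊗ₜ[k] (x2 i ⊗ₜ[k] y2 j)) ⊗ₜ[k] T (y1 j ⊗ₜ[k] (x3 i ⊗ₜ[k] y3 j)))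
    (x y : C →ₗc[k] X) (c : C) :
    θ (pair x y c) = pair (ternaryAct T x (pair x y)) (ternaryAct T y (pair x y)) c := by
  let T' : X ⊗[k] (X ⊗[k] X) →ₗ[k] X := T
  let W := X ⊗[k] X
  have key : θ = TensorProduct.map T' T' ∘ₗ (tensorTensorTensorComm k X X W W).toLinearMap ∘ₗ
      delta3 k := by
    ext x y
    obtain ⟨_, x1, x2, x3, hx⟩ := exists_rep3 (k := k) x
    obtain ⟨_, y1, y2, y3, hy⟩ := exists_rep3 (k := k) y
    simp [hθ x y x1 x2 x3 y1 y2 y3 hx hy, delta3_tmul_of_rep3 hx hy, T', W]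
  rw [key, LinearMap.comp_apply, LinearMap.comp_apply, delta3_apply_eq_pair, LinearEquiv.coe_coe,
    tensorTensorTensorComm_pair]
  exact map_pair_eq_pair _ _ _ _ _ _ (fun _ => rfl) (fun _ => rfl) c

theorem braiding_pair {β : (X ⊗[k] X) ⊗[k] (X ⊗[k] X) →ₗ[k] (X ⊗[k] X) ⊗[k] (X ⊗[k] X)}
    (hβ : ∀ (x x' y z : X) {n m : ℕ} (y1 y2 y3 : Fin n → X) (z1 z2 z3 : Fin m → X),
      Rep3 k y y1 y2 y3 → Rep3 k z z1 z2 z3 →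
      β ((x ⊗ₜ[k] x') ⊗ₜ[k] (y ⊗ₜ[k] z)) =
        ∑ i, ∑ j, (y1 i ⊗ₜ[k] z1 j) ⊗ₜ[k]
          (T (x ⊗ₜ[k] (y2 i ⊗ₜ[k] z2 j)) ⊗ₜ[k] T (x' ⊗ₜ[k] (y3 i ⊗ₜ[k] z3 j))))
    (x x' y z : C →ₗc[k] X) (c : C) :
    β (pair (pair x x') (pair y z) c) =
      pair (pair y z) (pair (ternaryAct T x (pair y z)) (ternaryAct T x' (pair y z))) c := by
  let T' : X ⊗[k] (X ⊗[k] X) →ₗ[k] X := T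
  let W := X ⊗[k] X
  have key : β = TensorProduct.map LinearMap.id
      (TensorProduct.map T' T' ∘ₗ (tensorTensorTensorComm k X X W W).toLinearMap) ∘ₗ
      (TensorProduct.leftComm k W W (W ⊗[k] W)).toLinearMap ∘ₗ
      TensorProduct.map LinearMap.id (delta3 k) := by
    ext x x' y z
    obtain ⟨_, y1, y2, y3, hy⟩ := exists_rep3 (k := k) y
    obtain ⟨_, z1, z2, z3, hz⟩ := exists_rep3 (k := k) z
    simp [hβ x x' y z y1 y2 y3 z1 z2 z3 hy hz, delta3_tmul_of_rep3 hy hz, tmul_sum, T', W]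
  rw [key, LinearMap.comp_apply, LinearMap.comp_apply,
    map_pair_eq_pair _ _ _ _ (pair x x') _ (fun _ => rfl) (delta3_apply_eq_pair (pair y z)),
    LinearEquiv.coe_coe, leftComm_pair]
  refine map_pair_eq_pair _ _ _ _ _ _ (fun _ => rfl) (fun c => ?_) c
  rw [LinearMap.comp_apply, LinearEquiv.coe_coe, tensorTensorTensorComm_pair]
  exact map_pair_eq_pair _ _ _ _ _ _ (fun _ => rfl) (fun _ => rfl) c

end Braiding

/-- the twist `θ` commutes with the braiding `β`:
`β ∘ (θ ⊗ id) = (id ⊗ θ) ∘ β` and `β ∘ (id ⊗ θ) = (θ ⊗ id) ∘ β`. -/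
theorem twist_commutes_with_braiding (k X : Type*) [CommRing k] [AddCommGroup X]
    [Module k X] [Coalgebra k X]
    (hcc : ∀ a : X, TensorProduct.comm k X X (Coalgebra.comul a) = Coalgebra.comul a)
    (T : X ⊗[k] (X ⊗[k] X) →ₗ[k] X)
    (hTSD : IsTSD k T) (hTinv : IsInvertibleTSD k T) (hTmor : IsCoalgMor k T)
    (θ : X ⊗[k] X →ₗ[k] X ⊗[k] X)
    (hθ : ∀ (x y : X) {n m : ℕ} (x1 x2 x3 : Fin n → X) (y1 y2 y3 : Fin m → X),
      Rep3 k x x1 x2 x3 → Rep3 k y y1 y2 y3 →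
      θ (x ⊗ₜ[k] y) = ∑ i, ∑ j,
        T (x1 i ⊗ₜ[k] (x2 i ⊗ₜ[k] y2 j)) ⊗ₜ[k] T (y1 j ⊗ₜ[k] (x3 i ⊗ₜ[k] y3 j)))
    (β : (X ⊗[k] X) ⊗[k] (X ⊗[k] X) →ₗ[k] (X ⊗[k] X) ⊗[k] (X ⊗[k] X))
    (hβ : ∀ (x x' y z : X) {n m : ℕ} (y1 y2 y3 : Fin n → X) (z1 z2 z3 : Fin m → X),
      Rep3 k y y1 y2 y3 → Rep3 k z z1 z2 z3 →
      β ((x ⊗ₜ[k] x') ⊗ₜ[k] (y ⊗ₜ[k] z)) =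
        ∑ i, ∑ j, (y1 i ⊗ₜ[k] z1 j) ⊗ₜ[k]
          (T (x ⊗ₜ[k] (y2 i ⊗ₜ[k] z2 j)) ⊗ₜ[k] T (x' ⊗ₜ[k] (y3 i ⊗ₜ[k] z3 j)))) :
    (β ∘ₗ TensorProduct.map θ LinearMap.id = TensorProduct.map LinearMap.id θ ∘ₗ β) ∧
    (β ∘ₗ TensorProduct.map LinearMap.id θ = TensorProduct.map θ LinearMap.id ∘ₗ β) := by
  have : Coalgebra.IsCocomm k X := ⟨LinearMap.ext hcc⟩
  obtain ⟨T, rfl⟩ : ∃ T' : X ⊗[k] (X ⊗[k] X) →ₗc[k] X, (T' : _ →ₗ[k] X) = T :=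
    ⟨hTmor.toCoalgHom, rfl⟩
  simp only [CoalgHom.coe_toLinearMap] at hθ hβ
  let x : (X ⊗[k] X) ⊗[k] (X ⊗[k] X) →ₗc[k] X :=
    (CoalgHom.fst k X X).comp (CoalgHom.fst k (X ⊗[k] X) (X ⊗[k] X))
  let x' : (X ⊗[k] X) ⊗[k] (X ⊗[k] X) →ₗc[k] X :=
    (CoalgHom.snd k X X).comp (CoalgHom.fst k (X ⊗[k] X) (X ⊗[k] X))
  let y : (X ⊗[k] X) ⊗[k] (X ⊗[k] X) →ₗc[k] X :=
    (CoalgHom.fst k X X).comp (CoalgHom.snd k (X ⊗[k] X) (X ⊗[k] X))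
  let z : (X ⊗[k] X) ⊗[k] (X ⊗[k] X) →ₗc[k] X :=
    (CoalgHom.snd k X X).comp (CoalgHom.snd k (X ⊗[k] X) (X ⊗[k] X))
  have hid : CoalgHom.pair (CoalgHom.pair x x') (CoalgHom.pair y z) =
      CoalgHom.id k ((X ⊗[k] X) ⊗[k] (X ⊗[k] X)) := by
    rw [← CoalgHom.pair_comp, ← CoalgHom.pair_comp, CoalgHom.pair_fst_snd,
      CoalgHom.id_comp, CoalgHom.id_comp, CoalgHom.pair_fst_snd]
  have hid' : ∀ c, c = CoalgHom.pair (CoalgHom.pair x x') (CoalgHom.pair y z) c := fun c => by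
    rw [hid]; rfl
  constructor
  · refine LinearMap.ext fun c => ?_
    rw [hid' c, LinearMap.comp_apply, LinearMap.comp_apply, braiding_pair hβ,
      CoalgHom.map_pair_eq_pair _ _ _ _ _ (CoalgHom.pair y z) (twist_pair hθ x x') (fun _ => rfl),
      braiding_pair hβ,
      CoalgHom.map_pair_eq_pair _ _ _ _ (CoalgHom.pair y z) _ (fun _ => rfl) (twist_pair hθ _ _),
      ternaryAct_ternaryAct hTSD x x x', ternaryAct_ternaryAct hTSD x' x x']
  · refine LinearMap.ext fun c => ?_
    rw [hid' c, LinearMap.comp_apply, LinearMap.comp_apply, braiding_pair hβ,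
      CoalgHom.map_pair_eq_pair _ _ _ _ (CoalgHom.pair x x') _ (fun _ => rfl) (twist_pair hθ y z),
      braiding_pair hβ,
      CoalgHom.map_pair_eq_pair _ _ _ _ _ (CoalgHom.pair _ _) (twist_pair hθ y z) (fun _ => rfl),
      ternaryAct_act_self hTSD hTinv, ternaryAct_act_self hTSD hTinv]
end

section
/- Let X be a commutative and cocommutative Hopf algebra over a commutative ring k with S ∘ S = id, and let λ : X → k be a two-sided integral functional. Set V = X⊗X, ∪(a⊗b) = λ(a·S(b)), and μ₂ = id_X ⊗ ∪ ⊗ id_X : V⊗V → V. Let θ : V → V be the twist θ(x⊗y) = T(x⁽¹⁾⊗x⁽²⁾⊗y⁽²⁾) ⊗ T(y⁽¹⁾⊗x⁽³⁾⊗y⁽³⁾) with T(x⊗y⊗z) = x·S(y)·z. Then for all x, y, z, w ∈ X, (θ ∘ μ₂)(x⊗y⊗z⊗w) = λ(y·S(z)) · ( w⁽²⁾ ⊗ w⁽¹⁾·S(x)·w⁽³⁾ ), as an identity of k-linear maps X^{⊗4} → X^{⊗2}. -/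
open TensorProduct

/-- `lam` is a two-sided integral functional. -/
def IsIntegralFunctional (k : Type*) {X : Type*} [CommRing k] [Ring X] [HopfAlgebra k X]
    (lam : X →ₗ[k] k) : Prop :=
  ∀ (x : X) {n : ℕ} (x1 x2 : Fin n → X), Rep2 k x x1 x2 →
    (∑ i, lam (x2 i) • x1 i = lam x • (1 : X)) ∧ (∑ i, lam (x1 i) • x2 i = lam x • (1 : X))

/-- Every element of a triple tensor product is a finite sum of pure tensors. -/
theorem exists_sum_tmul_tmul {k X : Type*} [CommRing k] [AddCommMonoid X] [Module k X]
    (t : X ⊗[k] (X ⊗[k] X)) :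
    ∃ (n : ℕ) (a b c : Fin n → X), t = ∑ i, a i ⊗ₜ[k] (b i ⊗ₜ[k] c i) := by
  have add : ∀ s t : X ⊗[k] (X ⊗[k] X),
      (∃ (n : ℕ) (a b c : Fin n → X), s = ∑ i, a i ⊗ₜ[k] (b i ⊗ₜ[k] c i)) →
      (∃ (n : ℕ) (a b c : Fin n → X), t = ∑ i, a i ⊗ₜ[k] (b i ⊗ₜ[k] c i)) →
      ∃ (n : ℕ) (a b c : Fin n → X), s + t = ∑ i, a i ⊗ₜ[k] (b i ⊗ₜ[k] c i) := by
    rintro _ _ ⟨m, a, b, c, rfl⟩ ⟨n, a', b', c', rfl⟩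
    exact ⟨m + n, Fin.append a a', Fin.append b b', Fin.append c c', by simp [Fin.sum_univ_add]⟩
  induction t using TensorProduct.induction_on with
  | zero => exact ⟨0, Fin.elim0, Fin.elim0, Fin.elim0, by simp⟩
  | add s t hs ht => exact add s t hs ht
  | tmul x u =>
    induction u using TensorProduct.induction_on with
    | zero => exact ⟨0, Fin.elim0, Fin.elim0, Fin.elim0, by simp⟩
    | add s t hs ht => rw [tmul_add]; exact add _ _ hs ht
    | tmul y z => exact ⟨1, fun _ => x, fun _ => y, fun _ => z, by simp⟩

/-- In Sweedler notation, `x⁽¹⁾·S(x⁽²⁾) ⊗ x⁽³⁾ = 1 ⊗ x`. -/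
theorem Rep3.sum_mul_antipode_tmul {k X : Type*} [CommRing k] [Ring X] [HopfAlgebra k X]
    {x : X} {n : ℕ} {x1 x2 x3 : Fin n → X} (hx : Rep3 k x x1 x2 x3) :
    ∑ i, (x1 i * HopfAlgebra.antipode k (x2 i)) ⊗ₜ[k] x3 i = 1 ⊗ₜ[k] x := by
  let f : X ⊗[k] X →ₗ[k] X := LinearMap.mul' k X ∘ₗ (HopfAlgebra.antipode k).lTensor X
  have hf : f ∘ₗ Coalgebra.comul = Algebra.linearMap k X ∘ₗ Coalgebra.counit :=
    HopfAlgebra.mul_antipode_lTensor_comul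
  have h : (TensorProduct.assoc k X X X).symm (delta3 k x) =
      Coalgebra.comul.rTensor X (Coalgebra.comul (R := k) x) :=
    Coalgebra.coassoc_symm_apply x
  have h' := congrArg (f.rTensor X) h
  rw [← LinearMap.rTensor_comp_apply X f Coalgebra.comul, hf, LinearMap.rTensor_comp_apply X
    (Algebra.linearMap k X), Coalgebra.rTensor_counit_comul, hx] at h'
  simpa [f] using h'

/-- `(θ ∘ μ₂)(x⊗y⊗z⊗w) = λ(y·S(z)) · (w⁽²⁾ ⊗ w⁽¹⁾·S(x)·w⁽³⁾)`. -/
theorem twist_mu_formula (k X : Type*) [CommRing k] [CommRing X] [HopfAlgebra k X]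
    (S : X →ₗ[k] X) (hS : S = HopfAlgebra.antipode (R := k))
    (hinv : ∀ a : X, S (S a) = a)
    (hcc : ∀ a : X, TensorProduct.comm k X X (Coalgebra.comul a) = Coalgebra.comul a)
    (lam : X →ₗ[k] k) (hlam : IsIntegralFunctional k lam)
    (μ₂ : (X ⊗[k] X) ⊗[k] (X ⊗[k] X) →ₗ[k] X ⊗[k] X)
    (hμ : ∀ x y z w : X,
      μ₂ ((x ⊗ₜ[k] y) ⊗ₜ[k] (z ⊗ₜ[k] w)) = lam (y * S z) • (x ⊗ₜ[k] w))
    (θ : X ⊗[k] X →ₗ[k] X ⊗[k] X)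
    (hθ : ∀ (x y : X) {n m : ℕ} (x1 x2 x3 : Fin n → X) (y1 y2 y3 : Fin m → X),
      Rep3 k x x1 x2 x3 → Rep3 k y y1 y2 y3 →
      θ (x ⊗ₜ[k] y) = ∑ i, ∑ j,
        (x1 i * S (x2 i) * y2 j) ⊗ₜ[k] (y1 j * S (x3 i) * y3 j))
    (x y z w : X) {n : ℕ} (w1 w2 w3 : Fin n → X) (hw : Rep3 k w w1 w2 w3) :
    θ (μ₂ ((x ⊗ₜ[k] y) ⊗ₜ[k] (z ⊗ₜ[k] w))) =
      lam (y * S z) • ∑ i, w2 i ⊗ₜ[k] (w1 i * S x * w3 i) := by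
  subst hS
  obtain ⟨m, x1, x2, x3, hx⟩ := exists_sum_tmul_tmul (delta3 k x)
  rw [hμ, map_smul, hθ x w x1 x2 x3 w1 w2 w3 hx hw, Finset.sum_comm]
  congr 1
  refine Finset.sum_congr rfl fun j _ => ?_
  have h := congrArg (TensorProduct.map (LinearMap.mulRight k (w2 j))
    (LinearMap.mulRight k (w3 j) ∘ₗ LinearMap.mulLeft k (w1 j) ∘ₗ HopfAlgebra.antipode k))
    (Rep3.sum_mul_antipode_tmul hx)
  simpa using h
end
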